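/- There is a universal constant C > 0 such that the following holds. Let (X,Π) be a two-sided γ-local-spectral expander and f ∈ C_k. Then for every i ≤ k, the Bottom-Up level function g_i approximately lies in the kernel of the down operator: ‖D_i g_i‖₂ ≤ C·i·2^i·γ·‖D_i^k f‖₂. -/

import Mathlib

open Finset

/-- Functions on faces of a complex on vertex set `Fin n`. -/
abbrev Cf (n : ℕ) := Finset (Fin n) → ℝ

/-- A `d`-dimensional weighted pure simplicial complex on vertex set `Fin n`:
the downward closure of a `d`-uniform hypergraph `faces d`, together with a
probability distribution on the top faces inducing distributions `w i` on each
level `faces i` via `π_i(x) = (1/(i+1))·Σ_{y ⊃ x} π_{i+1}(y)`. -/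
structure WSC (n d : ℕ) where
  faces : ℕ → Finset (Finset (Fin n))
  top_nonempty : (faces d).Nonempty
  card_mem : ∀ i, ∀ s ∈ faces i, s.card = i
  empty_levels : ∀ i, d < i → faces i = ∅
  downward : ∀ i, i < d → ∀ s : Finset (Fin n),
    s ∈ faces i ↔ (s.card = i ∧ ∃ t ∈ faces (i+1), s ⊆ t)
  w : ℕ → Finset (Fin n) → ℝ
  w_nonneg : ∀ i s, 0 ≤ w i s
  w_pos : ∀ i, ∀ s ∈ faces i, 0 < w i s
  w_zero : ∀ i s, s ∉ faces i → w i s = 0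
  w_top_sum : ∑ s ∈ faces d, w d s = 1
  w_rec : ∀ i, i < d → ∀ s ∈ faces i,
    w i s = (1/(i+1 : ℝ)) * ∑ t ∈ (faces (i+1)).filter (fun t => s ⊆ t), w (i+1) t

variable {n d : ℕ}

/-- The up operator `U_k : C_k → C_{k+1}`. -/
noncomputable def Uop (X : WSC n d) (k : ℕ) (f : Cf n) : Cf n := fun τ =>
  (1/(k+1 : ℝ)) * ∑ σ ∈ (X.faces k).filter (fun σ => σ ⊆ τ), f σ

/-- The down operator `D_{k+1} : C_{k+1} → C_k`. -/
noncomputable def Dop (X : WSC n d) (k : ℕ) (f : Cf n) : Cf n := fun τ =>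
  (∑ σ ∈ (X.faces (k+1)).filter (fun σ => τ ⊆ σ), X.w (k+1) σ * f σ) /
  (∑ σ ∈ (X.faces (k+1)).filter (fun σ => τ ⊆ σ), X.w (k+1) σ)

/-- `Uc X i m : C_i → C_{i+m}` is the iterated up operator; `U_i^k = Uc X i (k-i)`. -/
noncomputable def Uc (X : WSC n d) (i : ℕ) : ℕ → Cf n → Cf n
  | 0, f => f
  | m+1, f => Uop X (i+m) (Uc X i m f)

/-- `Dc X k m : C_k → C_{k-m}` is the iterated down operator; `D_i^k = Dc X k (k-i)`. -/
noncomputable def Dc (X : WSC n d) (k : ℕ) : ℕ → Cf n → Cf n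
  | 0, f => f
  | m+1, f => Dop X (k - (m+1)) (Dc X k m f)

/-- Bottom-Up level functions: `g_i = D_i^k f − Σ_{j<i} C(i,j)·U_j^i g_j ∈ C_i`. -/
noncomputable def gLevel (X : WSC n d) (k : ℕ) (f : Cf n) : ℕ → Cf n
  | i => Dc X k (k - i) f - ∑ j ∈ (Finset.range i).attach,
      ((i.choose j.1 : ℝ)) • Uc X j.1 (i - j.1) (gLevel X k f j.1)
  termination_by i => i
  decreasing_by exact Finset.mem_range.mp j.2

/-- Lifted Bottom-Up level functions: `f_i^↑ = C(k,i)·U_i^k g_i ∈ C_k`. -/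
noncomputable def fLevel (X : WSC n d) (k : ℕ) (f : Cf n) (i : ℕ) : Cf n :=
  ((k.choose i : ℝ)) • Uc X i (k - i) (gLevel X k f i)

/-- Inner product at level `i`: `⟨f,g⟩ = E_{τ∼π_i}[f(τ)g(τ)]`. -/
noncomputable def ip (X : WSC n d) (i : ℕ) (f g : Cf n) : ℝ :=
  ∑ τ ∈ X.faces i, X.w i τ * f τ * g τ

/-- Expectation at level `i`. -/
noncomputable def EE (X : WSC n d) (i : ℕ) (f : Cf n) : ℝ :=
  ∑ τ ∈ X.faces i, X.w i τ * f τ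

/-- `L²` norm at level `i`. -/
noncomputable def norm2 (X : WSC n d) (i : ℕ) (f : Cf n) : ℝ := Real.sqrt (ip X i f f)

/-- `L^p` norm at level `i`. -/
noncomputable def normP (X : WSC n d) (i : ℕ) (p : ℝ) (f : Cf n) : ℝ :=
  (∑ τ ∈ X.faces i, X.w i τ * |f τ| ^ p) ^ (1/p)

/-- `L^∞` norm at level `i` : the maximum of `|f|` over `i`-faces. -/
noncomputable def normInf (X : WSC n d) (i : ℕ) (f : Cf n) : ℝ :=
  ⨆ τ : {σ // σ ∈ X.faces i}, |f τ.1|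

/-- `E_{X_τ}[f|_τ]`: the weighted mean of `f ∈ C_k` over `k`-faces containing `τ`. -/
noncomputable def linkMean (X : WSC n d) (k : ℕ) (τ : Finset (Fin n)) (f : Cf n) : ℝ :=
  (∑ ρ ∈ (X.faces k).filter (fun ρ => τ ⊆ ρ), X.w k ρ * f ρ) /
  (∑ ρ ∈ (X.faces k).filter (fun ρ => τ ⊆ ρ), X.w k ρ)

/-- `⟨f|_τ, g|_τ⟩` over the link `X_τ` with its induced distribution, for `f, g ∈ C_k`. -/
noncomputable def linkIp (X : WSC n d) (k : ℕ) (τ : Finset (Fin n)) (f g : Cf n) : ℝ :=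
  (∑ ρ ∈ (X.faces k).filter (fun ρ => τ ⊆ ρ), X.w k ρ * f ρ * g ρ) /
  (∑ ρ ∈ (X.faces k).filter (fun ρ => τ ⊆ ρ), X.w k ρ)

/-- `f ∈ C_k` is `(ε,i)`-pseudorandom: `|E_{X_τ}[f|_τ]| ≤ ε‖f‖_∞` and
`⟨f|_τ,f|_τ⟩ ≤ ε‖f‖_∞²` for every `i`-face `τ`. -/
def Pseudorandom (X : WSC n d) (k : ℕ) (ε : ℝ) (i : ℕ) (f : Cf n) : Prop :=
  ∀ τ ∈ X.faces i, |linkMean X k τ f| ≤ ε * normInf X k f ∧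
    linkIp X k τ f f ≤ ε * (normInf X k f)^2

/-- Boolean ({0,1}-valued) function on `X(k)`. -/
def IsBool (X : WSC n d) (k : ℕ) (f : Cf n) : Prop := ∀ τ ∈ X.faces k, f τ = 0 ∨ f τ = 1

/-- Total influence `I[f] = ⟨f, k(Id − U_{k−1}D_k) f⟩`. -/
noncomputable def influence (X : WSC n d) (k : ℕ) (f : Cf n) : ℝ :=
  (k : ℝ) * (ip X k f f - ip X k f (Uop X (k-1) (Dop X (k-1) f)))

/-- Variance `Var(f) = E[f²] − E[f]²`. -/
noncomputable def variance (X : WSC n d) (k : ℕ) (f : Cf n) : ℝ :=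
  ip X k f f - (EE X k f)^2

/-- The noise operator `T_ρ = Σ_{i=0}^k C(k,i)(1−ρ)^i ρ^{k−i} U_{k−i}^k D_{k−i}^k`. -/
noncomputable def noiseOp (X : WSC n d) (k : ℕ) (ρ : ℝ) (f : Cf n) : Cf n :=
  ∑ i ∈ Finset.range (k+1),
    ((k.choose i : ℝ) * (1-ρ)^i * ρ^(k-i)) • Uc X (k-i) i (Dc X k i f)

/-- Noise stability `Stab_ρ(f) = ⟨f, T_ρ f⟩`. -/
noncomputable def stab (X : WSC n d) (k : ℕ) (ρ : ℝ) (f : Cf n) : ℝ :=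
  ip X k f (noiseOp X k ρ f)

/-- Edge weights of the underlying graph of the link of `s ∈ X(i)`. -/
noncomputable def edgeW (X : WSC n d) (i : ℕ) (s : Finset (Fin n)) (u v : Fin n) : ℝ :=
  if u ≠ v ∧ u ∉ s ∧ v ∉ s ∧ insert u (insert v s) ∈ X.faces (i+2)
  then X.w (i+2) (insert u (insert v s)) else 0

/-- Vertex weights of the underlying graph of the link of `s ∈ X(i)`. -/
noncomputable def vertW (X : WSC n d) (i : ℕ) (s : Finset (Fin n)) (u : Fin n) : ℝ :=
  ∑ v, edgeW X i s u v

/-- `X` is a two-sided `γ`-local-spectral expander: for every `i ≤ d−2` and every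
`s ∈ X(i)` (including `s = ∅`), every nontrivial eigenvalue of the weighted adjacency
operator of the graph `(X_s(1), X_s(2))` has absolute value at most `γ`, expressed via
the quadratic form on functions orthogonal to constants. -/
def IsLSE (X : WSC n d) (γ : ℝ) : Prop :=
  ∀ i, i + 2 ≤ d → ∀ s ∈ X.faces i, ∀ f : Fin n → ℝ,
    (∑ u, vertW X i s u * f u) = 0 →
    |∑ u, ∑ v, edgeW X i s u v * f u * f v| ≤ γ * ∑ u, vertW X i s u * (f u)^2

/-- The swap walk `S_{j,i} : C_i → C_j`: `(S_{j,i} f)(τ)` is the weighted mean of `f(σ)`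
over `i`-faces `σ` disjoint from `τ` with `τ ∪ σ ∈ X(i+j)`. -/
noncomputable def swapW (X : WSC n d) (j i : ℕ) (f : Cf n) : Cf n := fun τ =>
  (∑ σ ∈ (X.faces i).filter (fun σ => Disjoint σ τ ∧ σ ∪ τ ∈ X.faces (i+j)),
      X.w (i+j) (σ ∪ τ) * f σ) /
  (∑ σ ∈ (X.faces i).filter (fun σ => Disjoint σ τ ∧ σ ∪ τ ∈ X.faces (i+j)),
      X.w (i+j) (σ ∪ τ))

/-- Localized mean: `E_{σ ∼ π_{v,i}}[f(σ)]`, the mean of `f ∈ C_i` over the `i`-faces of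
the link `X_v` of `v ∈ X(j)`, with respect to the distribution induced by the link. -/
noncomputable def locMean (X : WSC n d) (i j : ℕ) (v : Finset (Fin n)) (f : Cf n) : ℝ :=
  (∑ σ ∈ (X.faces i).filter (fun σ => Disjoint σ v ∧ σ ∪ v ∈ X.faces (i+j)),
      X.w (i+j) (σ ∪ v) * f σ) /
  (∑ σ ∈ (X.faces i).filter (fun σ => Disjoint σ v ∧ σ ∪ v ∈ X.faces (i+j)),
      X.w (i+j) (σ ∪ v))

/-- The `m`-faces of the link `X_τ`. -/
noncomputable def lkFaces (X : WSC n d) (τ : Finset (Fin n)) (m : ℕ) : Finset (Finset (Fin n)) :=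
  (Finset.univ : Finset (Finset (Fin n))).filter
    (fun σ => Disjoint σ τ ∧ σ ∪ τ ∈ X.faces (τ.card + m))

/-- Inner product at level `m` of the link `X_τ` (with the induced distribution). -/
noncomputable def lkIp (X : WSC n d) (τ : Finset (Fin n)) (m : ℕ) (f g : Cf n) : ℝ :=
  (∑ σ ∈ lkFaces X τ m, X.w (τ.card + m) (σ ∪ τ) * f σ * g σ) /
  (∑ σ ∈ lkFaces X τ m, X.w (τ.card + m) (σ ∪ τ))

/-- `L²` norm at level `m` of the link `X_τ`. -/
noncomputable def lkNorm2 (X : WSC n d) (τ : Finset (Fin n)) (m : ℕ) (f : Cf n) : ℝ :=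
  Real.sqrt (lkIp X τ m f f)

/-- Global mean at level `m` of the link `X_τ` (the stationary operator `U_0^j D_0^m`
of the swap walk on `X_τ` applied to `f`). -/
noncomputable def lkMeanLvl (X : WSC n d) (τ : Finset (Fin n)) (m : ℕ) (f : Cf n) : ℝ :=
  (∑ σ ∈ lkFaces X τ m, X.w (τ.card + m) (σ ∪ τ) * f σ) /
  (∑ σ ∈ lkFaces X τ m, X.w (τ.card + m) (σ ∪ τ))

/-- The swap walk `S_{j,m}` within the link `X_τ`. -/
noncomputable def lkSwap (X : WSC n d) (τ : Finset (Fin n)) (j m : ℕ) (f : Cf n) : Cf n := fun v =>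
  (∑ σ ∈ (lkFaces X τ m).filter (fun σ => Disjoint σ v ∧ σ ∪ v ∈ lkFaces X τ (m+j)),
      X.w (τ.card + m + j) (σ ∪ v ∪ τ) * f σ) /
  (∑ σ ∈ (lkFaces X τ m).filter (fun σ => Disjoint σ v ∧ σ ∪ v ∈ lkFaces X τ (m+j)),
      X.w (τ.card + m + j) (σ ∪ v ∪ τ))

/-- Restriction `f|_τ(σ) = f(τ ∪ σ)`. -/
def restrictF (τ : Finset (Fin n)) (f : Cf n) : Cf n := fun σ => f (τ ∪ σ)

/-- The Bottom-Up level function of the restriction `f|_υ` computed within the link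
`X_υ` (via its explicit form): `g_ℓ^{(υ)}(I) = Σ_{T ⊆ I} (−1)^{|I∖T|}·E_{(X_υ)_T}[f|_υ]`. -/
noncomputable def gLink (X : WSC n d) (k : ℕ) (f : Cf n) (υ : Finset (Fin n)) : Cf n :=
  fun I => ∑ σ ∈ I.powerset, (-1:ℝ)^((I \ σ).card) * linkMean X k (υ ∪ σ) f

section WeightedLinks

/-- Möbius inversion on the Boolean lattice. -/
theorem sum_powerset_neg_one_pow_mul_sum {V : Type*} [DecidableEq V] (s : Finset V) (g : Finset V → ℝ) :
    ∑ T ∈ s.powerset, (-1 : ℝ) ^ (s \ T).card * ∑ R ∈ T.powerset, g R = g s := by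
  induction s using Finset.induction_on generalizing g with
  | empty => simp
  | insert a s ha ih =>
    rw [Finset.sum_powerset_insert ha, ← Finset.sum_add_distrib, ← ih (fun R => g (insert a R))]
    refine Finset.sum_congr rfl fun T hT => ?_
    have haT : a ∉ T := fun h => ha (mem_powerset.1 hT h)
    have h1 : (insert a s \ T).card = (s \ T).card + 1 := by
      rw [insert_sdiff_of_notMem _ haT, card_insert_of_notMem (by simp [ha])]
    have h2 : insert a s \ insert a T = s \ T := by
      ext x
      simp only [mem_sdiff, mem_insert]
      constructor
      · tauto
      · rintro ⟨h, h'⟩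
        refine ⟨Or.inr h, ?_⟩
        rintro (rfl | h'')
        · exact ha h
        · exact h' h''
    rw [h1, h2, Finset.sum_powerset_insert haT, pow_succ]
    ring

theorem sum_powerset_neg_one_pow_mul_sub {V : Type*} [DecidableEq V] (s : Finset V) (v : V) (hv : v ∉ s)
    (g : Finset V → ℝ) :
    ∑ T ∈ s.powerset, (-1 : ℝ) ^ (s \ T).card *
      (∑ R ∈ (insert v T).powerset, g R - ∑ R ∈ T.powerset, g R) = g (insert v s) := by
  rw [← sum_powerset_neg_one_pow_mul_sum s (fun R => g (insert v R))]
  refine Finset.sum_congr rfl fun T hT => ?_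
  rw [Finset.sum_powerset_insert (fun h => hv (mem_powerset.1 hT h))]
  ring

/-- A bound on the quadratic form of a symmetric weighted graph on mean-zero functions bounds
the `L²` norm of the adjacency operator on them. -/
theorem sum_sq_adjacency_le {V : Type*} [Fintype V] (e : V → V → ℝ) (p : V → ℝ) (γ : ℝ) (hγ : 0 ≤ γ)
    (he : ∀ u v, 0 ≤ e u v) (hsymm : ∀ u v, e u v = e v u) (hp : ∀ u, p u = ∑ v, e u v)
    (hform : ∀ f : V → ℝ, ∑ u, p u * f u = 0 →
      |∑ u, ∑ v, e u v * f u * f v| ≤ γ * ∑ u, p u * (f u) ^ 2)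
    (f : V → ℝ) (hf : ∑ u, p u * f u = 0) :
    ∑ u, p u * ((∑ v, e u v * f v) / p u) ^ 2 ≤ γ ^ 2 * ∑ u, p u * (f u) ^ 2 := by
  have hp0 : ∀ u, 0 ≤ p u := fun u => by rw [hp]; exact sum_nonneg fun v _ => he u v
  set A : V → ℝ := fun u => (∑ v, e u v * f v) / p u with hA
  have hpA : ∀ u, p u * A u = ∑ v, e u v * f v := by
    intro u
    by_cases h : p u = 0
    · have : ∀ v, e u v = 0 := by
        intro v
        rw [hp] at h
        exact (sum_eq_zero_iff_of_nonneg fun v _ => he u v).1 h v (mem_univ v)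
      simp [h, this]
    · simp only [hA]
      field_simp
  have hAmean : ∑ u, p u * A u = 0 := by
    simp_rw [hpA]
    rw [sum_comm, ← hf]
    refine sum_congr rfl fun v _ => ?_
    rw [hp, sum_mul]
    exact sum_congr rfl fun u _ => by rw [hsymm]
  set N := ∑ u, p u * (f u) ^ 2 with hN
  set M := ∑ u, p u * (A u) ^ 2 with hM
  have hM0 : 0 ≤ M := sum_nonneg fun u _ => mul_nonneg (hp0 u) (sq_nonneg _)
  have hcross : ∑ u, ∑ v, e u v * A u * f v = M := by
    refine sum_congr rfl fun u _ => ?_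
    rw [pow_two, ← mul_assoc, hpA, sum_mul]
    exact sum_congr rfl fun v _ => by ring
  have hcross' : ∑ u, ∑ v, e u v * f u * A v = M := by
    rw [← hcross, sum_comm]
    exact sum_congr rfl fun u _ => sum_congr rfl fun v _ => by rw [hsymm]; ring
  have key : ∀ t : ℝ, 2 * t * M ≤ γ * (N + t ^ 2 * M) := by
    intro t
    have hmean : ∀ s : ℝ, ∑ u, p u * (f u + s * A u) = 0 := by
      intro s
      have : ∑ u, p u * (f u + s * A u) = ∑ u, p u * f u + s * ∑ u, p u * A u := by
        rw [mul_sum, ← sum_add_distrib]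
        exact sum_congr rfl fun u _ => by ring
      rw [this, hf, hAmean]; ring
    have hq : ∀ s : ℝ, ∑ u, ∑ v, e u v * (f u + s * A u) * (f v + s * A v) =
        ∑ u, ∑ v, e u v * f u * f v + 2 * s * M + s ^ 2 * ∑ u, ∑ v, e u v * A u * A v := by
      intro s
      have : 2 * s * M = s * (∑ u, ∑ v, e u v * A u * f v) + s * ∑ u, ∑ v, e u v * f u * A v := by
        rw [hcross, hcross']; ring
      rw [this]
      simp_rw [mul_sum, ← sum_add_distrib]
      exact sum_congr rfl fun u _ => sum_congr rfl fun v _ => by ring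
    have hn : ∀ s : ℝ, ∑ u, p u * (f u + s * A u) ^ 2 =
        N + 2 * s * (∑ u, p u * f u * A u) + s ^ 2 * M := by
      intro s
      simp_rw [hN, hM, mul_sum, ← sum_add_distrib]
      exact sum_congr rfl fun u _ => by ring
    have h1 := (abs_le.1 (hform _ (hmean t))).2
    have h2 := (abs_le.1 (hform _ (hmean (-t)))).1
    rw [hq, hn] at h1 h2
    linarith
  rcases hγ.eq_or_lt with h | h
  · have := key 1
    rw [← h] at this ⊢
    linarith
  · have := key γ⁻¹
    field_simp at this
    nlinarith

variable {V : Type*} [Fintype V] [DecidableEq V]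

/-- The sets of cardinality `r` containing `T`. -/
def supersetsCard (T : Finset V) (r : ℕ) : Finset (Finset V) :=
  univ.filter (fun S => T ⊆ S ∧ S.card = r)

theorem mem_supersetsCard {T S : Finset V} {r : ℕ} :
    S ∈ supersetsCard T r ↔ T ⊆ S ∧ S.card = r := by
  simp [supersetsCard]

theorem supersetsCard_self (T : Finset V) : supersetsCard T T.card = {T} := by
  ext S
  simp only [mem_supersetsCard, mem_singleton]
  exact ⟨fun h => (eq_of_subset_of_card_le h.1 h.2.le).symm, by rintro rfl; simp⟩

/-- Pairs `(S, v)` with `v ∉ S` correspond to pairs `(R, v)` with `v ∈ R` via `R = insert v S`. -/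
theorem sum_supersetsCard_compl (T : Finset V) (r : ℕ) (F : Finset V → Finset V → V → ℝ) :
    ∑ S ∈ supersetsCard T r, ∑ v ∈ Sᶜ, F S (insert v S) v =
      ∑ R ∈ supersetsCard T (r + 1), ∑ v ∈ R \ T, F (R.erase v) R v := by
  rw [Finset.sum_sigma', Finset.sum_sigma']
  refine Finset.sum_bij' (fun p _ => ⟨insert p.2 p.1, p.2⟩) (fun p _ => ⟨p.1.erase p.2, p.2⟩)
    ?_ ?_ ?_ ?_ ?_
  · rintro ⟨S, v⟩ h
    simp only [mem_sigma, mem_supersetsCard, mem_compl, mem_sdiff] at h ⊢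
    obtain ⟨⟨h1, h2⟩, h3⟩ := h
    exact ⟨⟨h1.trans (subset_insert _ _), by rw [card_insert_of_notMem h3, h2]⟩,
      mem_insert_self _ _, fun h => h3 (h1 h)⟩
  · rintro ⟨S, v⟩ h
    simp only [mem_sigma, mem_supersetsCard, mem_compl, mem_sdiff] at h ⊢
    obtain ⟨⟨h1, h2⟩, h3, h4⟩ := h
    exact ⟨⟨subset_erase.2 ⟨h1, h4⟩, by rw [card_erase_of_mem h3, h2]; rfl⟩, notMem_erase _ _⟩
  · rintro ⟨S, v⟩ h
    simp only [mem_sigma, mem_compl] at h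
    simp [erase_insert h.2]
  · rintro ⟨S, v⟩ h
    simp only [mem_sigma, mem_sdiff] at h
    simp [insert_erase h.2.1]
  · rintro ⟨S, v⟩ h
    simp only [mem_sigma, mem_compl] at h
    simp [erase_insert h.2]

variable (W : Finset V → ℝ) (d : ℕ)

/-- The mean of `φ` over the vertices of the link of `S`, for face weights `W`. -/
noncomputable def vertexMean (S : Finset V) (φ : V → ℝ) : ℝ :=
  (∑ v ∈ Sᶜ, W (insert v S) * φ v) / ((S.card + 1) * W S)

variable {W d}

theorem weight_insert_eq_zero (hW : ∀ S, 0 ≤ W S)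
    (hrec : ∀ S : Finset V, S.card < d → ∑ v ∈ Sᶜ, W (insert v S) = (S.card + 1) * W S)
    {S : Finset V} (hS : S.card < d) (h : W S = 0) {v : V} (hv : v ∉ S) :
    W (insert v S) = 0 := by
  have := hrec S hS
  rw [h, mul_zero] at this
  exact (sum_eq_zero_iff_of_nonneg fun v _ => hW _).1 this v (mem_compl.2 hv)

theorem weight_mul_vertexMean (hW : ∀ S, 0 ≤ W S)
    (hrec : ∀ S : Finset V, S.card < d → ∑ v ∈ Sᶜ, W (insert v S) = (S.card + 1) * W S)
    {S : Finset V} (hS : S.card < d) (φ : V → ℝ) :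
    (S.card + 1) * W S * vertexMean W S φ = ∑ v ∈ Sᶜ, W (insert v S) * φ v := by
  by_cases h : W S = 0
  · rw [h, mul_zero, zero_mul, eq_comm]
    refine sum_eq_zero fun v hv => ?_
    rw [weight_insert_eq_zero hW hrec hS h (mem_compl.1 hv), zero_mul]
  · unfold vertexMean
    have : (S.card + 1 : ℝ) ≠ 0 := by positivity
    field_simp

theorem sum_weight_supersetsCard
    (hrec : ∀ S : Finset V, S.card < d → ∑ v ∈ Sᶜ, W (insert v S) = (S.card + 1) * W S)
    (T : Finset V) (m : ℕ) (hm : T.card + m ≤ d) :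
    ∑ S ∈ supersetsCard T (T.card + m), W S = (T.card + m).choose m * W T := by
  induction m with
  | zero =>
    rw [add_zero, supersetsCard_self]; simp
  | succ m ih =>
    have h := sum_supersetsCard_compl T (T.card + m) (fun _ R _ => W R)
    have hl : ∑ S ∈ supersetsCard T (T.card + m), ∑ v ∈ Sᶜ, W (insert v S) =
        (T.card + m + 1) * ∑ S ∈ supersetsCard T (T.card + m), W S := by
      rw [mul_sum]
      refine sum_congr rfl fun S hS => ?_
      rw [mem_supersetsCard] at hS
      rw [hrec S (by omega), hS.2]
      push_cast; ring
    have hr : ∑ R ∈ supersetsCard T (T.card + m + 1), ∑ _v ∈ R \ T, W R =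
        (m + 1) * ∑ R ∈ supersetsCard T (T.card + m + 1), W R := by
      rw [mul_sum]
      refine sum_congr rfl fun S hS => ?_
      rw [mem_supersetsCard] at hS
      rw [sum_const, card_sdiff_of_subset hS.1, hS.2, nsmul_eq_mul,
        show T.card + m + 1 - T.card = m + 1 by omega]
      push_cast; ring
    rw [hl, hr, ih (by omega)] at h
    have hc : ((T.card + m + 1 : ℕ) : ℝ) * (T.card + m).choose m =
        (T.card + m + 1).choose (m + 1) * (m + 1 : ℕ) := by
      exact_mod_cast Nat.add_one_mul_choose_eq (T.card + m) m
    push_cast at hc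
    have hm1 : (m + 1 : ℝ) ≠ 0 := by positivity
    apply mul_left_cancel₀ hm1
    rw [← add_assoc, ← h]
    linear_combination W T * hc

theorem sum_supersetsCard_weight_insert
    (hrec : ∀ S : Finset V, S.card < d → ∑ v ∈ Sᶜ, W (insert v S) = (S.card + 1) * W S)
    (T : Finset V) (m : ℕ) (hm : T.card + m + 1 ≤ d) (ψ : V → ℝ) :
    ∑ S ∈ supersetsCard T (T.card + m), ∑ v ∈ Sᶜ, W (insert v S) * ψ v =
      (T.card + m + 1).choose m * ∑ v ∈ Tᶜ, W (insert v T) * ψ v := by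
  rw [sum_supersetsCard_compl T (T.card + m) (fun _ R v => W R * ψ v), mul_sum,
    sum_comm' (t' := Tᶜ) (s' := fun v => supersetsCard (insert v T) (T.card + m + 1))]
  · refine sum_congr rfl fun v hv => ?_
    have hc : (insert v T).card = T.card + 1 := card_insert_of_notMem (mem_compl.1 hv)
    have := sum_weight_supersetsCard hrec (insert v T) m (by omega)
    rw [hc, show T.card + 1 + m = T.card + m + 1 by omega] at this
    rw [← sum_mul, this]; ring
  · intro R v
    simp only [mem_supersetsCard, mem_sdiff, mem_compl, insert_subset_iff]
    tauto

/-- Iterating one-step contraction along chains from `T`: the mean of `φ` over the link of a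
random superset of `T` is close to its mean over the link of `T`. -/
theorem sum_supersetsCard_sq_vertexMean_sub_le (hW : ∀ S, 0 ≤ W S)
    (hrec : ∀ S : Finset V, S.card < d → ∑ v ∈ Sᶜ, W (insert v S) = (S.card + 1) * W S)
    (γ : ℝ) (φ : V → ℝ)
    (hstep : ∀ S : Finset V, S.card + 2 ≤ d →
      ∑ t ∈ Sᶜ, W (insert t S) * (vertexMean W (insert t S) φ - vertexMean W S φ) ^ 2 ≤
        γ ^ 2 * ∑ v ∈ Sᶜ, W (insert v S) * (φ v) ^ 2)
    (T : Finset V) (m : ℕ) (hm : T.card + m + 1 ≤ d) :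
    (T.card + 1) * ∑ S ∈ supersetsCard T (T.card + m),
        W S * (vertexMean W S φ - vertexMean W T φ) ^ 2 ≤
      m ^ 2 * γ ^ 2 * (T.card + m).choose m * ∑ v ∈ Tᶜ, W (insert v T) * (φ v) ^ 2 := by
  induction m with
  | zero =>
    rw [sum_eq_zero]
    · simp
    · intro S hS
      rw [mem_supersetsCard] at hS
      rw [eq_of_subset_of_card_le hS.1 hS.2.le]
      ring
  | succ m ih =>
    specialize ih (by omega)
    set a := vertexMean W T φ
    set B := ∑ v ∈ Tᶜ, W (insert v T) * (φ v) ^ 2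
    set N := ∑ S ∈ supersetsCard T (T.card + m), W S * (vertexMean W S φ - a) ^ 2
    set N' := ∑ S ∈ supersetsCard T (T.card + (m + 1)), W S * (vertexMean W S φ - a) ^ 2 with hN'
    have hcount : ∑ S ∈ supersetsCard T (T.card + m), ∑ t ∈ Sᶜ,
        W (insert t S) * (vertexMean W (insert t S) φ - a) ^ 2 = (m + 1) * N' := by
      rw [sum_supersetsCard_compl T (T.card + m) (fun _ R _ => W R * (vertexMean W R φ - a) ^ 2),
        hN', mul_sum]
      refine sum_congr rfl fun S hS => ?_
      rw [mem_supersetsCard] at hS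
      rw [sum_const, card_sdiff_of_subset hS.1, hS.2, nsmul_eq_mul,
        show T.card + (m + 1) - T.card = m + 1 by omega]
      push_cast; ring
    have hX : ∑ S ∈ supersetsCard T (T.card + m), ∑ t ∈ Sᶜ,
        W (insert t S) * (vertexMean W (insert t S) φ - vertexMean W S φ) ^ 2 ≤
          γ ^ 2 * ((T.card + m + 1).choose m * B) := by
      rw [← sum_supersetsCard_weight_insert hrec T m (by omega) (fun v => (φ v) ^ 2), mul_sum]
      refine sum_le_sum fun S hS => hstep S ?_
      rw [mem_supersetsCard] at hS
      omega
    have hY : ∑ S ∈ supersetsCard T (T.card + m), ∑ t ∈ Sᶜ,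
        W (insert t S) * (vertexMean W S φ - a) ^ 2 = (T.card + m + 1) * N := by
      rw [mul_sum]
      refine sum_congr rfl fun S hS => ?_
      rw [mem_supersetsCard] at hS
      rw [← sum_mul, hrec S (by omega), hS.2]
      push_cast; ring
    have hsplit : (m + 1) * N' ≤ (m + 1) * (γ ^ 2 * ((T.card + m + 1).choose m * B)) +
        (m + 1) / m * ((T.card + m + 1) * N) := by
      rw [← hcount, ← hY]
      refine le_trans ?_ (add_le_add_left (mul_le_mul_of_nonneg_left hX (by positivity)) _)
      simp_rw [mul_sum, ← sum_add_distrib]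
      refine sum_le_sum fun S hS => sum_le_sum fun t _ => ?_
      rw [mem_supersetsCard] at hS
      set x := vertexMean W (insert t S) φ - vertexMean W S φ with hx
      set y := vertexMean W S φ - a with hy
      have hxy : vertexMean W (insert t S) φ - a = x + y := by rw [hx, hy]; ring
      have hsq : (x + y) ^ 2 ≤ (m + 1) * x ^ 2 + (m + 1) / m * y ^ 2 := by
        rcases Nat.eq_zero_or_pos m with h0 | h0
        · have hST : T = S := eq_of_subset_of_card_le hS.1 (by omega)
          have : y = 0 := by rw [hy, ← hST]; exact sub_self _
          rw [this, h0]; simp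
        · have hm0 : (0 : ℝ) < m := by exact_mod_cast h0
          have : (m + 1) * x ^ 2 + (m + 1) / m * y ^ 2 - (x + y) ^ 2 = (m * x - y) ^ 2 / m := by
            field_simp; ring
          have h2 : 0 ≤ (m * x - y) ^ 2 / m := by positivity
          linarith
      rw [hxy]
      nlinarith [mul_le_mul_of_nonneg_left hsq (hW (insert t S))]
    have hm1 : (0 : ℝ) < m + 1 := by positivity
    have hj1 : (0 : ℝ) < T.card + 1 := by positivity
    have hNdiv : (T.card + 1) * (N / m) ≤ m * γ ^ 2 * (T.card + m).choose m * B := by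
      rcases Nat.eq_zero_or_pos m with h0 | h0
      · simp [h0]
      · have hm0 : (0 : ℝ) < m := by exact_mod_cast h0
        rw [← mul_div_assoc, div_le_iff₀ hm0]
        linarith
    have hN1 : N' ≤ γ ^ 2 * ((T.card + m + 1).choose m * B) + (T.card + m + 1) * (N / m) := by
      refine le_of_mul_le_mul_left (hsplit.trans_eq ?_) hm1
      ring
    have hc1 : ((T.card + m + 1 : ℕ) : ℝ) * (T.card + m).choose m =
        (T.card + m + 1).choose (m + 1) * (m + 1 : ℕ) := by
      exact_mod_cast Nat.add_one_mul_choose_eq (T.card + m) m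
    have hc2 : ((T.card + m + 1).choose m : ℝ) * (T.card + 1 : ℕ) =
        (T.card + m + 1 : ℕ) * (T.card + m).choose m := by
      have := Nat.choose_mul_succ_eq (T.card + m) m
      rw [show T.card + m + 1 - m = T.card + 1 by omega] at this
      rw [mul_comm ((T.card + m + 1 : ℕ) : ℝ)]
      exact_mod_cast this.symm
    push_cast at hc1 hc2 ⊢
    rw [← add_assoc]
    calc (T.card + 1) * N' ≤ (T.card + 1) *
          (γ ^ 2 * ((T.card + m + 1).choose m * B) + (T.card + m + 1) * (N / m)) := by gcongr
      _ = γ ^ 2 * B * ((T.card + m + 1) * (T.card + m).choose m) +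
          (T.card + m + 1) * ((T.card + 1) * (N / m)) := by rw [← hc2]; ring
      _ ≤ γ ^ 2 * B * ((T.card + m + 1) * (T.card + m).choose m) +
          (T.card + m + 1) * (m * γ ^ 2 * (T.card + m).choose m * B) := by gcongr
      _ = (m + 1) * γ ^ 2 * B * ((T.card + m + 1) * (T.card + m).choose m) := by ring
      _ = _ := by rw [hc1]; ring

theorem sum_compl_insert (T : Finset V) (F : Finset V → ℝ) :
    ∑ v ∈ Tᶜ, F (insert v T) = ∑ R ∈ supersetsCard T (T.card + 1), F R := by
  have h := sum_supersetsCard_compl T T.card (fun _ R _ => F R)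
  rw [supersetsCard_self, sum_singleton] at h
  rw [h]
  refine sum_congr rfl fun R hR => ?_
  rw [mem_supersetsCard] at hR
  rw [sum_const, card_sdiff_of_subset hR.1, hR.2, Nat.add_sub_cancel_left, one_smul]

theorem sum_supersetsCard_empty_compl (r : ℕ) (F : Finset V → ℝ) :
    ∑ T ∈ supersetsCard ∅ r, ∑ v ∈ Tᶜ, F (insert v T) =
      (r + 1) * ∑ R ∈ supersetsCard ∅ (r + 1), F R := by
  rw [sum_supersetsCard_compl ∅ r (fun _ R _ => F R), mul_sum]
  refine sum_congr rfl fun R hR => ?_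
  rw [mem_supersetsCard] at hR
  rw [sdiff_empty, sum_const, hR.2, nsmul_eq_mul]
  push_cast; ring

theorem vertexMean_sub (hrec : ∀ S : Finset V, S.card < d →
      ∑ v ∈ Sᶜ, W (insert v S) = (S.card + 1) * W S)
    {S : Finset V} (hS : S.card < d) (h : W S ≠ 0) (φ : V → ℝ) (c : ℝ) :
    vertexMean W S (fun v => φ v - c) = vertexMean W S φ - c := by
  have h1 : (S.card + 1 : ℝ) ≠ 0 := by positivity
  unfold vertexMean
  simp_rw [mul_sub, sum_sub_distrib, ← sum_mul, hrec S hS]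
  field_simp

theorem vertexMean_sum_smul (S : Finset V) {ι : Type*} (s : Finset ι) (c : ι → ℝ)
    (φ : ι → V → ℝ) :
    vertexMean W S (fun v => ∑ i ∈ s, c i * φ i v) = ∑ i ∈ s, c i * vertexMean W S (φ i) := by
  unfold vertexMean
  simp_rw [mul_sum]
  rw [sum_comm, sum_div]
  refine sum_congr rfl fun i _ => ?_
  rw [← mul_div_assoc, mul_sum]
  congr 1
  exact sum_congr rfl fun v _ => by ring

theorem sum_weight_mul_sq_sub_vertexMean (hW : ∀ S, 0 ≤ W S)
    (hrec : ∀ S : Finset V, S.card < d → ∑ v ∈ Sᶜ, W (insert v S) = (S.card + 1) * W S)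
    {S : Finset V} (hS : S.card < d) (φ : V → ℝ) :
    ∑ v ∈ Sᶜ, W (insert v S) * (φ v - vertexMean W S φ) ^ 2 =
      ∑ v ∈ Sᶜ, W (insert v S) * φ v ^ 2 - (S.card + 1) * (W S * vertexMean W S φ ^ 2) := by
  have hmean := weight_mul_vertexMean hW hrec hS φ
  generalize vertexMean W S φ = a at hmean ⊢
  have h : ∑ v ∈ Sᶜ, W (insert v S) * (φ v - a) ^ 2 = ∑ v ∈ Sᶜ, W (insert v S) * φ v ^ 2 -
      2 * a * ∑ v ∈ Sᶜ, W (insert v S) * φ v + a ^ 2 * ∑ v ∈ Sᶜ, W (insert v S) := by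
    rw [mul_sum, mul_sum, ← sum_sub_distrib, ← sum_add_distrib]
    exact sum_congr rfl fun v _ => by ring
  rw [h, ← hmean, hrec S hS]
  ring

theorem weight_mul_sq_vertexMean_le (hW : ∀ S, 0 ≤ W S)
    (hrec : ∀ S : Finset V, S.card < d → ∑ v ∈ Sᶜ, W (insert v S) = (S.card + 1) * W S)
    {S : Finset V} (hS : S.card < d) (φ : V → ℝ) :
    (S.card + 1) * (W S * vertexMean W S φ ^ 2) ≤ ∑ v ∈ Sᶜ, W (insert v S) * φ v ^ 2 := by
  rw [← sub_nonneg, ← sum_weight_mul_sq_sub_vertexMean hW hrec hS]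
  exact sum_nonneg fun v _ => mul_nonneg (hW _) (sq_nonneg _)

/-- The squared `L²` norm is monotone in the level, along functions related by averaging. -/
theorem sum_weight_mul_sq_mono (hW : ∀ S, 0 ≤ W S)
    (hrec : ∀ S : Finset V, S.card < d → ∑ v ∈ Sᶜ, W (insert v S) = (S.card + 1) * W S)
    {k : ℕ} (hk : k ≤ d) {H : Finset V → ℝ}
    (hH : ∀ S : Finset V, S.card < k → W S ≠ 0 → H S = vertexMean W S (fun v => H (insert v S)))
    {r s : ℕ} (hrs : r ≤ s) (hs : s ≤ k) :
    ∑ S ∈ supersetsCard ∅ r, W S * H S ^ 2 ≤ ∑ S ∈ supersetsCard ∅ s, W S * H S ^ 2 := by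
  induction s, hrs using Nat.le_induction with
  | base => exact le_rfl
  | succ s _ ih =>
    refine (ih (by omega)).trans ?_
    have h1 : (0 : ℝ) < s + 1 := by positivity
    refine le_of_mul_le_mul_left ?_ h1
    rw [← sum_supersetsCard_empty_compl s (fun R => W R * H R ^ 2), mul_sum]
    refine sum_le_sum fun S hS => ?_
    rw [mem_supersetsCard] at hS
    by_cases h : W S = 0
    · rw [h, zero_mul, mul_zero]
      exact sum_nonneg fun v _ => mul_nonneg (hW _) (sq_nonneg _)
    · have := weight_mul_sq_vertexMean_le hW hrec (S := S) (by omega) (fun v => H (insert v S))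
      rwa [← hH S (by omega) h, hS.2] at this

theorem sum_sq_vertexMean_alternating_le (hW : ∀ S, 0 ≤ W S)
    (hrec : ∀ S : Finset V, S.card < d → ∑ v ∈ Sᶜ, W (insert v S) = (S.card + 1) * W S)
    (γ : ℝ)
    (hstep : ∀ (φ : V → ℝ) (S : Finset V), S.card + 2 ≤ d →
      ∑ t ∈ Sᶜ, W (insert t S) * (vertexMean W (insert t S) φ - vertexMean W S φ) ^ 2 ≤
        γ ^ 2 * ∑ v ∈ Sᶜ, W (insert v S) * (φ v) ^ 2)
    (hsub : ∀ S T : Finset V, T ⊆ S → S.card ≤ d → W S ≠ 0 → W T ≠ 0)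
    {k : ℕ} (hk : k ≤ d) {H : Finset V → ℝ}
    (hH : ∀ S : Finset V, S.card < k → W S ≠ 0 → H S = vertexMean W S (fun v => H (insert v S)))
    (r : ℕ) (hr : r + 1 ≤ k) :
    ∑ S ∈ supersetsCard ∅ r, W S * vertexMean W S (fun v => ∑ T ∈ S.powerset,
        (-1 : ℝ) ^ (S \ T).card * (H (insert v T) - H T)) ^ 2 ≤
      (2 ^ r * r * γ) ^ 2 * ∑ S ∈ supersetsCard ∅ (r + 1), W S * H S ^ 2 := by
  set Q := ∑ S ∈ supersetsCard ∅ (r + 1), W S * H S ^ 2 with hQ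
  have hcs : ∀ S ∈ supersetsCard (∅ : Finset V) r,
      W S * vertexMean W S (fun v => ∑ T ∈ S.powerset,
        (-1 : ℝ) ^ (S \ T).card * (H (insert v T) - H T)) ^ 2 ≤
      2 ^ r * ∑ T ∈ S.powerset, W S * (vertexMean W S (fun v => H (insert v T)) -
        vertexMean W T (fun v => H (insert v T))) ^ 2 := by
    intro S hS
    rw [mem_supersetsCard] at hS
    by_cases h : W S = 0
    · simp [h]
    rw [vertexMean_sum_smul, ← mul_sum, mul_left_comm]
    refine mul_le_mul_of_nonneg_left ?_ (hW S)
    refine (sq_sum_le_card_mul_sum_sq).trans_eq ?_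
    rw [card_powerset, hS.2]
    push_cast
    congr 1
    refine sum_congr rfl fun T hT => ?_
    have hT' := mem_powerset.1 hT
    have hTS := card_le_card hT'
    rw [mul_pow, ← pow_mul, mul_comm _ 2, pow_mul, neg_one_sq, one_pow, one_mul,
      vertexMean_sub hrec (by omega) h,
      ← hH T (by omega) (hsub S T hT' (by omega) h)]
  refine (sum_le_sum hcs).trans ?_
  rw [← mul_sum, sum_comm' (t' := (range (r + 1)).biUnion (fun j => supersetsCard (∅ : Finset V) j))
    (s' := fun T => supersetsCard T r), sum_biUnion]
  · have hlevel : ∀ j ∈ range (r + 1), ∑ T ∈ supersetsCard (∅ : Finset V) j,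
        ∑ S ∈ supersetsCard T r, W S * (vertexMean W S (fun v => H (insert v T)) -
          vertexMean W T (fun v => H (insert v T))) ^ 2 ≤ r ^ 2 * γ ^ 2 * Q * r.choose j := by
      intro j hj
      have hj : j ≤ r := by simpa [Nat.lt_succ_iff] using hj
      have h1 : (0 : ℝ) < j + 1 := by positivity
      refine le_of_mul_le_mul_left ?_ h1
      have hQj := sum_weight_mul_sq_mono hW hrec hk hH (r := j + 1) (s := r + 1) (by omega) hr
      rw [← hQ] at hQj
      calc _ ≤ ∑ T ∈ supersetsCard (∅ : Finset V) j, r ^ 2 * γ ^ 2 * r.choose j *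
            ∑ v ∈ Tᶜ, W (insert v T) * H (insert v T) ^ 2 := by
              rw [mul_sum]
              refine sum_le_sum fun T hT => ?_
              rw [mem_supersetsCard] at hT
              have := sum_supersetsCard_sq_vertexMean_sub_le hW hrec γ
                (fun v => H (insert v T)) (hstep _) T (r - j) (by omega)
              rw [hT.2, Nat.add_sub_cancel' hj, Nat.choose_symm hj] at this
              refine this.trans ?_
              have hB : 0 ≤ ∑ v ∈ Tᶜ, W (insert v T) * H (insert v T) ^ 2 :=
                sum_nonneg fun v _ => mul_nonneg (hW _) (sq_nonneg _)
              have hle : ((r - j : ℕ) : ℝ) ≤ r := by exact_mod_cast Nat.sub_le r j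
              gcongr
        _ = r ^ 2 * γ ^ 2 * r.choose j * ((j + 1) *
            ∑ S ∈ supersetsCard ∅ (j + 1), W S * H S ^ 2) := by
              rw [← mul_sum, ← sum_supersetsCard_empty_compl j (fun R => W R * H R ^ 2)]
        _ ≤ r ^ 2 * γ ^ 2 * r.choose j * ((j + 1) * Q) := by gcongr
        _ = _ := by ring
    have hsum : (∑ j ∈ range (r + 1), (r.choose j : ℝ)) = 2 ^ r := by
      exact_mod_cast Nat.sum_range_choose r
    refine (mul_le_mul_of_nonneg_left (sum_le_sum hlevel) (by positivity)).trans_eq ?_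
    rw [← mul_sum, hsum]
    ring
  · intro a _ b _ hab
    rw [Function.onFun, disjoint_left]
    intro S hS hS'
    rw [mem_supersetsCard] at hS hS'
    exact hab (hS.2.symm.trans hS'.2)
  · intro S T
    simp only [mem_supersetsCard, mem_powerset, mem_biUnion, mem_range, empty_subset, true_and]
    constructor
    · rintro ⟨h1, h2⟩
      exact ⟨⟨h2, h1⟩, T.card, by have := card_le_card h2; omega, rfl⟩
    · rintro ⟨⟨h1, h2⟩, _⟩
      exact ⟨h2, h1⟩

end WeightedLinks

section Complex

/-- The weight of a set, as a face of the level given by its cardinality. -/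
def faceWeight (X : WSC n d) (S : Finset (Fin n)) : ℝ := X.w S.card S

theorem faceWeight_nonneg (X : WSC n d) (S : Finset (Fin n)) : 0 ≤ faceWeight X S :=
  X.w_nonneg _ _

theorem faceWeight_ne_zero_iff (X : WSC n d) (S : Finset (Fin n)) :
    faceWeight X S ≠ 0 ↔ S ∈ X.faces S.card := by
  refine ⟨fun h => ?_, fun h => (X.w_pos _ _ h).ne'⟩
  by_contra h'
  exact h (X.w_zero _ _ h')

theorem mem_faces_of_subset (X : WSC n d) {S T : Finset (Fin n)} (hTS : T ⊆ S)
    (hS : S ∈ X.faces S.card) : T ∈ X.faces T.card := by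
  induction S using Finset.strongInduction with
  | H S ih =>
    rcases hTS.eq_or_ssubset with rfl | h
    · exact hS
    · obtain ⟨v, hv, hvT⟩ := exists_of_ssubset h
      refine ih _ (erase_ssubset hv) (subset_erase.2 ⟨hTS, hvT⟩) ?_
      have hcard : (S.erase v).card + 1 = S.card := card_erase_add_one hv
      have hd : S.card ≤ d := by
        by_contra hd
        rw [X.empty_levels _ (not_le.1 hd)] at hS
        exact notMem_empty _ hS
      refine (X.downward _ (by omega) _).2 ⟨rfl, S, ?_, erase_subset _ _⟩
      rwa [hcard]

theorem sum_faces_filter_superset (X : WSC n d) (τ : Finset (Fin n)) (f : Cf n) :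
    ∑ σ ∈ (X.faces (τ.card + 1)).filter (fun σ => τ ⊆ σ), X.w (τ.card + 1) σ * f σ =
      ∑ v ∈ τᶜ, faceWeight X (insert v τ) * f (insert v τ) := by
  rw [sum_compl_insert τ (fun R => faceWeight X R * f R)]
  have hsub : (X.faces (τ.card + 1)).filter (fun σ => τ ⊆ σ) ⊆ supersetsCard τ (τ.card + 1) := by
    intro σ hσ
    rw [mem_filter] at hσ
    exact mem_supersetsCard.2 ⟨hσ.2, X.card_mem _ _ hσ.1⟩
  rw [← sum_subset hsub]
  · refine sum_congr rfl fun σ hσ => ?_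
    rw [faceWeight, X.card_mem _ _ (mem_filter.1 hσ).1]
  · intro σ hσ hσ'
    rw [mem_supersetsCard] at hσ
    have : σ ∉ X.faces (τ.card + 1) := fun h => hσ' (mem_filter.2 ⟨h, hσ.1⟩)
    rw [faceWeight, hσ.2, X.w_zero _ _ this, zero_mul]

theorem sum_faceWeight_insert (X : WSC n d) (S : Finset (Fin n)) (hS : S.card < d) :
    ∑ v ∈ Sᶜ, faceWeight X (insert v S) = (S.card + 1) * faceWeight X S := by
  by_cases h : S ∈ X.faces S.card
  · have h1 := sum_faces_filter_superset X S (fun _ => 1)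
    simp only [mul_one] at h1
    have : (S.card + 1 : ℝ) ≠ 0 := by positivity
    rw [← h1, faceWeight, X.w_rec _ hS S h]
    field_simp
  · have h0 : faceWeight X S = 0 := not_not.1 fun h' => h ((faceWeight_ne_zero_iff X S).1 h')
    rw [h0, mul_zero]
    refine sum_eq_zero fun v _ => ?_
    by_contra h'
    exact h (mem_faces_of_subset X (subset_insert v S) ((faceWeight_ne_zero_iff X _).1 h'))

theorem Dop_eq_vertexMean (X : WSC n d) (f : Cf n) (τ : Finset (Fin n)) (hτ : τ.card < d) :
    Dop X τ.card f τ = vertexMean (faceWeight X) τ (fun v => f (insert v τ)) := by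
  have h1 := sum_faces_filter_superset X τ (fun _ => 1)
  simp only [mul_one] at h1
  rw [Dop, sum_faces_filter_superset, h1, sum_faceWeight_insert X τ hτ, vertexMean]

theorem ip_self_eq (X : WSC n d) (r : ℕ) (f : Cf n) :
    ip X r f f = ∑ S ∈ supersetsCard ∅ r, faceWeight X S * f S ^ 2 := by
  have hsub : X.faces r ⊆ supersetsCard ∅ r := fun S hS =>
    mem_supersetsCard.2 ⟨empty_subset _, X.card_mem _ _ hS⟩
  rw [ip, ← sum_subset hsub]
  · refine sum_congr rfl fun S hS => ?_
    rw [faceWeight, X.card_mem _ _ hS]; ring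
  · intro S hS hS'
    rw [mem_supersetsCard] at hS
    rw [faceWeight, hS.2, X.w_zero _ _ hS', zero_mul]

theorem edgeW_nonneg (X : WSC n d) (i : ℕ) (S : Finset (Fin n)) (u v : Fin n) :
    0 ≤ edgeW X i S u v := by
  unfold edgeW
  split_ifs
  · exact X.w_nonneg _ _
  · exact le_rfl

theorem edgeW_comm (X : WSC n d) (i : ℕ) (S : Finset (Fin n)) (u v : Fin n) :
    edgeW X i S u v = edgeW X i S v u := by
  unfold edgeW
  rw [insert_comm v u S]
  refine if_congr ?_ rfl rfl
  rw [ne_comm]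
  tauto

theorem edgeW_of_mem (X : WSC n d) {S : Finset (Fin n)} {u : Fin n} (hu : u ∈ S) (i : ℕ)
    (v : Fin n) : edgeW X i S u v = 0 :=
  if_neg fun h => h.2.1 hu

theorem edgeW_of_notMem (X : WSC n d) {S : Finset (Fin n)} {u v : Fin n} (hu : u ∉ S)
    (hv : v ∉ insert u S) : edgeW X S.card S u v = faceWeight X (insert v (insert u S)) := by
  have hcard : (insert v (insert u S)).card = S.card + 2 := by
    rw [card_insert_of_notMem hv, card_insert_of_notMem hu]
  rw [mem_insert, not_or] at hv
  unfold edgeW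
  rw [faceWeight, hcard, insert_comm u v S]
  split_ifs with h
  · rfl
  · rw [X.w_zero]
    exact fun h' => h ⟨Ne.symm hv.1, hu, hv.2, h'⟩

theorem sum_edgeW_mul (X : WSC n d) {S : Finset (Fin n)} {u : Fin n} (hu : u ∉ S)
    (φ : Fin n → ℝ) :
    ∑ v, edgeW X S.card S u v * φ v =
      ∑ v ∈ (insert u S)ᶜ, faceWeight X (insert v (insert u S)) * φ v := by
  rw [← sum_subset (subset_univ (insert u S)ᶜ)]
  · refine sum_congr rfl fun v hv => ?_
    rw [edgeW_of_notMem X hu (mem_compl.1 hv)]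
  · intro v _ hv
    rw [mem_compl, not_not, mem_insert] at hv
    rw [edgeW, if_neg, zero_mul]
    rintro ⟨h1, _, h2, _⟩
    rcases hv with h | h
    · exact h1 h.symm
    · exact h2 h

theorem vertW_of_notMem (X : WSC n d) {S : Finset (Fin n)} (hS : S.card + 2 ≤ d) {u : Fin n}
    (hu : u ∉ S) : vertW X S.card S u = (S.card + 2) * faceWeight X (insert u S) := by
  have h := sum_edgeW_mul X hu (fun _ => 1)
  simp only [mul_one] at h
  have hc := card_insert_of_notMem hu
  rw [vertW, h, sum_faceWeight_insert X _ (by omega), hc]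
  push_cast; ring

theorem sum_vertW_mul (X : WSC n d) {S : Finset (Fin n)} (hS : S.card + 2 ≤ d)
    (φ : Fin n → ℝ) :
    ∑ u, vertW X S.card S u * φ u =
      (S.card + 2) * ∑ u ∈ Sᶜ, faceWeight X (insert u S) * φ u := by
  rw [← sum_subset (subset_univ Sᶜ), mul_sum]
  · refine sum_congr rfl fun u hu => ?_
    rw [vertW_of_notMem X hS (mem_compl.1 hu)]; ring
  · intro u _ hu
    rw [mem_compl, not_not] at hu
    rw [vertW, sum_eq_zero fun v _ => edgeW_of_mem X hu _ v, zero_mul]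

/-- In a local-spectral expander, moving from the link of `S` to the link of `insert t S` changes
the vertex mean of `φ` by at most `γ` in `L²`. -/
theorem sum_sq_vertexMean_insert_sub_le (X : WSC n d) {γ : ℝ} (hγ : 0 ≤ γ) (hX : IsLSE X γ)
    (φ : Fin n → ℝ) (S : Finset (Fin n)) (hS : S.card + 2 ≤ d) :
    ∑ t ∈ Sᶜ, faceWeight X (insert t S) *
        (vertexMean (faceWeight X) (insert t S) φ - vertexMean (faceWeight X) S φ) ^ 2 ≤
      γ ^ 2 * ∑ v ∈ Sᶜ, faceWeight X (insert v S) * (φ v) ^ 2 := by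
  have hW := faceWeight_nonneg X
  have hrec := sum_faceWeight_insert X
  by_cases hface : S ∈ X.faces S.card
  swap
  · have h0 : faceWeight X S = 0 := not_not.1 fun h' => hface ((faceWeight_ne_zero_iff X S).1 h')
    rw [sum_eq_zero fun t ht => ?_]
    · exact mul_nonneg (sq_nonneg _) (sum_nonneg fun v _ => mul_nonneg (hW _) (sq_nonneg _))
    · rw [weight_insert_eq_zero hW hrec (by omega) h0 (mem_compl.1 ht), zero_mul]
  set c := vertexMean (faceWeight X) S φ with hc
  have hmean : ∑ u, vertW X S.card S u * (φ u - c) = 0 := by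
    rw [sum_vertW_mul X hS]
    simp_rw [mul_sub, sum_sub_distrib]
    rw [← sum_mul, hrec S (by omega), ← weight_mul_vertexMean hW hrec (by omega) φ, ← hc]
    ring
  have hgap := sum_sq_adjacency_le (edgeW X S.card S) (vertW X S.card S) γ hγ
    (edgeW_nonneg X _ S) (edgeW_comm X _ S) (fun _ => rfl) (hX S.card hS S hface)
    (fun u => φ u - c) hmean
  rw [sum_vertW_mul X hS, sum_vertW_mul X hS, mul_left_comm] at hgap
  have hgap' := le_of_mul_le_mul_left hgap (by positivity)
  have hvar : ∑ v ∈ Sᶜ, faceWeight X (insert v S) * (φ v - c) ^ 2 ≤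
      ∑ v ∈ Sᶜ, faceWeight X (insert v S) * (φ v) ^ 2 := by
    rw [hc, sum_weight_mul_sq_sub_vertexMean hW hrec (by omega)]
    have := mul_nonneg (by positivity : (0 : ℝ) ≤ S.card + 1)
      (mul_nonneg (hW S) (sq_nonneg (vertexMean (faceWeight X) S φ)))
    linarith
  refine le_trans (le_of_eq (sum_congr rfl fun t ht => ?_))
    (hgap'.trans (mul_le_mul_of_nonneg_left hvar (sq_nonneg _)))
  have ht' := mem_compl.1 ht
  by_cases h0 : faceWeight X (insert t S) = 0
  · rw [h0, zero_mul, zero_mul]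
  have hcard := card_insert_of_notMem ht'
  rw [sum_edgeW_mul X ht', vertW_of_notMem X hS ht',
    ← vertexMean_sub hrec (by omega) h0, vertexMean, hcard]
  push_cast
  ring

theorem sum_powersetCard_pred {V : Type*} [DecidableEq V] (τ : Finset V) (r : ℕ)
    (hτ : τ.card = r + 1) (F : Finset V → ℝ) :
    ∑ σ ∈ powersetCard r τ, F σ = ∑ v ∈ τ, F (τ.erase v) := by
  symm
  refine sum_bij (fun v _ => τ.erase v) ?_ ?_ ?_ (fun _ _ => rfl)
  · intro v hv
    exact mem_powersetCard.2 ⟨erase_subset _ _, by rw [card_erase_of_mem hv, hτ]; rfl⟩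
  · intro v hv v' hv' h
    exact erase_injOn τ hv hv' h
  · intro σ hσ
    rw [mem_powersetCard] at hσ
    have h1 : (τ \ σ).card = 1 := by rw [card_sdiff_of_subset hσ.1]; omega
    obtain ⟨v, hv⟩ := card_eq_one.1 h1
    refine ⟨v, (mem_sdiff.1 (hv ▸ mem_singleton_self v)).1, ?_⟩
    rw [erase_eq, ← hv, Finset.sdiff_sdiff_eq_self hσ.1]

theorem choose_mul_Uc (X : WSC n d) (j m : ℕ) (g : Cf n) (τ : Finset (Fin n))
    (hτ : τ ∈ X.faces (j + m)) :
    ((j + m).choose j : ℝ) * Uc X j m g τ = ∑ T ∈ powersetCard j τ, g T := by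
  have hcard := X.card_mem _ _ hτ
  induction m generalizing τ with
  | zero =>
    rw [show powersetCard j τ = {τ} by rw [show j = τ.card from hcard.symm, powersetCard_self]]
    simp [Uc]
  | succ m ih =>
    have hfilter : (X.faces (j + m)).filter (fun σ => σ ⊆ τ) = powersetCard (j + m) τ := by
      ext σ
      rw [mem_filter, mem_powersetCard]
      constructor
      · rintro ⟨h1, h2⟩
        exact ⟨h2, X.card_mem _ _ h1⟩
      · rintro ⟨h1, h2⟩
        refine ⟨?_, h1⟩
        have := mem_faces_of_subset X h1 (hcard ▸ hτ)
        rwa [h2] at this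
    have hsum : ((j + m).choose j : ℝ) * ∑ σ ∈ powersetCard (j + m) τ, Uc X j m g σ =
        (m + 1) * ∑ T ∈ powersetCard j τ, g T := by
      have h1 : ((j + m).choose j : ℝ) * ∑ σ ∈ powersetCard (j + m) τ, Uc X j m g σ =
          ∑ σ ∈ powersetCard (j + m) τ, ∑ T ∈ powersetCard j σ, g T := by
        rw [mul_sum]
        refine sum_congr rfl fun σ hσ => ?_
        rw [← hfilter, mem_filter] at hσ
        exact ih σ hσ.1 (X.card_mem _ _ hσ.1)
      rw [h1, sum_powersetCard_pred τ (j + m) hcard,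
        sum_comm' (t' := powersetCard j τ) (s' := fun T => τ \ T), mul_sum]
      · refine sum_congr rfl fun T hT => ?_
        rw [mem_powersetCard] at hT
        rw [sum_const, card_sdiff_of_subset hT.1, hcard, hT.2, nsmul_eq_mul,
          show j + (m + 1) - j = m + 1 by omega]
        push_cast; ring
      · intro v T
        simp only [mem_powersetCard, mem_sdiff, subset_erase]
        tauto
    have hc : ((j + m).choose j : ℝ) * (j + m + 1 : ℕ) =
        (j + m + 1).choose j * (m + 1 : ℕ) := by
      have := Nat.choose_mul_succ_eq (j + m) j
      rw [show j + m + 1 - j = m + 1 by omega] at this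
      exact_mod_cast this
    push_cast at hc
    have hj : (j + m + 1 : ℝ) ≠ 0 := by positivity
    have hm1 : (m + 1 : ℝ) ≠ 0 := by positivity
    rw [Uc, Uop, hfilter, ← add_assoc]
    push_cast
    apply mul_left_cancel₀ hm1
    rw [← hsum]
    generalize ∑ σ ∈ powersetCard (j + m) τ, Uc X j m g σ = s
    field_simp
    linear_combination -s * hc

/-- All the functions `D_i^k f` at once: the value on `S` is that of level `i = |S|`. -/
noncomputable def downLevels (X : WSC n d) (k : ℕ) (f : Cf n) : Cf n :=
  fun S => Dc X k (k - S.card) f S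

theorem downLevels_eq_vertexMean (X : WSC n d) {k : ℕ} (hk : k ≤ d) (f : Cf n)
    (S : Finset (Fin n)) (hS : S.card < k) :
    downLevels X k f S =
      vertexMean (faceWeight X) S (fun v => downLevels X k f (insert v S)) := by
  obtain ⟨m, hm⟩ : ∃ m, k - S.card = m + 1 := ⟨k - S.card - 1, by omega⟩
  rw [downLevels, hm, Dc, show k - (m + 1) = S.card by omega,
    Dop_eq_vertexMean X _ S (by omega), vertexMean, vertexMean]
  congr 1
  refine sum_congr rfl fun v hv => ?_
  rw [downLevels, card_insert_of_notMem (mem_compl.1 hv), show k - (S.card + 1) = m by omega]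

theorem sum_powerset_gLevel (X : WSC n d) (k : ℕ) (f : Cf n) (τ : Finset (Fin n))
    (hτ : τ ∈ X.faces τ.card) :
    ∑ T ∈ τ.powerset, gLevel X k f T.card T = downLevels X k f τ := by
  have hlevels : ∀ j, ∑ T ∈ powersetCard j τ, gLevel X k f T.card T =
      ∑ T ∈ powersetCard j τ, gLevel X k f j T := fun j =>
    sum_congr rfl fun T hT => by rw [(mem_powersetCard.1 hT).2]
  rw [sum_powerset, sum_range_succ, powersetCard_self, sum_singleton, gLevel,
    sum_attach (range τ.card)
      (fun j => (τ.card.choose j : ℝ) • Uc X j (τ.card - j) (gLevel X k f j)),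
    Pi.sub_apply, Finset.sum_apply, downLevels, add_comm, sub_add_eq_add_sub, sub_eq_iff_eq_add]
  congr 1
  refine sum_congr rfl fun j hj => ?_
  have hj := mem_range.1 hj
  have hadd : j + (τ.card - j) = τ.card := by omega
  have := choose_mul_Uc X j (τ.card - j) (gLevel X k f j) τ (by rwa [hadd])
  rw [hadd] at this
  rw [hlevels, ← this, Pi.smul_apply, smul_eq_mul]

/-- The level function of an extension as an alternating sum of differences of `D_j^k f`. -/
theorem gLevel_insert (X : WSC n d) (k : ℕ) (f : Cf n) {S : Finset (Fin n)} {v : Fin n}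
    (hv : v ∉ S) (hface : insert v S ∈ X.faces (insert v S).card) :
    gLevel X k f (S.card + 1) (insert v S) = ∑ T ∈ S.powerset, (-1 : ℝ) ^ (S \ T).card *
      (downLevels X k f (insert v T) - downLevels X k f T) := by
  have h := sum_powerset_neg_one_pow_mul_sub S v hv (fun T => gLevel X k f T.card T)
  rw [card_insert_of_notMem hv] at h
  rw [← h]
  refine sum_congr rfl fun T hT => ?_
  have hT := mem_powerset.1 hT
  rw [sum_powerset_gLevel X k f _ (mem_faces_of_subset X (insert_subset_insert v hT) hface),
    sum_powerset_gLevel X k f _ (mem_faces_of_subset X (hT.trans (subset_insert v S)) hface)]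

theorem ip_Dop_gLevel_le (X : WSC n d) {γ : ℝ} (hγ : 0 ≤ γ) (hX : IsLSE X γ) {k : ℕ}
    (hk : k ≤ d) (f : Cf n) (r : ℕ) (hr : r + 1 ≤ k) :
    ip X r (Dop X r (gLevel X k f (r + 1))) (Dop X r (gLevel X k f (r + 1))) ≤
      (2 ^ r * r * γ) ^ 2 *
        ip X (r + 1) (Dc X k (k - (r + 1)) f) (Dc X k (k - (r + 1)) f) := by
  have h := sum_sq_vertexMean_alternating_le (faceWeight_nonneg X) (sum_faceWeight_insert X) γ
    (sum_sq_vertexMean_insert_sub_le X hγ hX)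
    (fun S T hTS _ hS => (faceWeight_ne_zero_iff X T).2
      (mem_faces_of_subset X hTS ((faceWeight_ne_zero_iff X S).1 hS)))
    hk (fun S hS _ => downLevels_eq_vertexMean X hk f S hS) r hr
  rw [ip_self_eq, ip_self_eq]
  convert h using 1
  · refine sum_congr rfl fun S hS => ?_
    obtain ⟨_, rfl⟩ := mem_supersetsCard.1 hS
    rw [Dop_eq_vertexMean X _ S (by omega), vertexMean, vertexMean]
    congr 3
    refine sum_congr rfl fun v hv => ?_
    by_cases h0 : faceWeight X (insert v S) = 0
    · rw [h0, zero_mul, zero_mul]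
    · rw [gLevel_insert X k f (mem_compl.1 hv) ((faceWeight_ne_zero_iff X _).1 h0)]
  · congr 1
    refine sum_congr rfl fun S hS => ?_
    rw [downLevels, (mem_supersetsCard.1 hS).2]

end Complex

/-- approximate kernel: there is a universal constant `C > 0` such
that on any two-sided `γ`-local-spectral expander, for `f ∈ C_k` and `1 ≤ i ≤ k`,
`‖D_i g_i‖₂ ≤ C·i·2^i·γ·‖D_i^k f‖₂`. -/
theorem stmt4 : ∃ C : ℝ, 0 < C ∧
    ∀ (n d : ℕ) (X : WSC n d) (γ : ℝ), 0 ≤ γ → IsLSE X γ →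
    ∀ (k : ℕ), k ≤ d → ∀ (f : Cf n) (i : ℕ), 1 ≤ i → i ≤ k →
    norm2 X (i-1) (Dop X (i-1) (gLevel X k f i)) ≤
      C * (i : ℝ) * (2:ℝ)^i * γ * norm2 X i (Dc X k (k-i) f) := by
  refine ⟨1, one_pos, fun n d X γ hγ hX k hk f i hi hik => ?_⟩
  obtain ⟨r, rfl⟩ : ∃ r, i = r + 1 := ⟨i - 1, by omega⟩
  rw [Nat.add_sub_cancel]
  unfold norm2
  refine (Real.sqrt_le_sqrt (ip_Dop_gLevel_le X hγ hX hk f r hik)).trans ?_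
  rw [Real.sqrt_mul (sq_nonneg _), Real.sqrt_sq (by positivity)]
  refine mul_le_mul_of_nonneg_right (mul_le_mul_of_nonneg_right ?_ hγ) (Real.sqrt_nonneg _)
  have h2 : (0 : ℝ) < 2 ^ r := by positivity
  have hr : (0 : ℝ) ≤ r := by positivity
  push_cast
  rw [pow_succ]
  nlinarith [mul_nonneg h2.le hr]
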